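/- arXiv:1603.01454 — 7 statements merged into one kernel-verified Lean document; each statement's English description precedes it below -/
import Mathlib

section
/- Let (e,ι,π) be an extension of a by b and let σ : b → e be a k-linear map with π ∘ σ = id_b. Then for all x,y ∈ b and c ∈ a the elements σ(x)·ι(c), ι(c)·σ(x) and σ(x)σ(y) − σ(x y) of e lie in the range of ι, and the uniquely determined maps L, R : b → End_k(a) and ω : b × b → a satisfying ι(L x c) = σ(x) ι(c), ι(R x c) = ι(c) σ(x) and ι(ω x y) = σ(x) σ(y) − σ(x y) are k-linear (respectively k-bilinear) and form an associative extension datum for (a,b), i.e., they satisfy conditions (i)–(vii). (Necessity part of Corollary 2.7, following Lemma 2.4.) -/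
/-- Necessity part of Corollary 2.7 (following Lemma 2.4): given an extension
`(e, ι, π)` of `a` by `b` and a `k`-linear section `σ` of `π`, the elements
`σ(x)·ι(c)`, `ι(c)·σ(x)` and `σ(x)σ(y) − σ(xy)` lie in the range of `ι`, and
the maps `L`, `R`, `ω` determined by `ι (L x c) = σ x * ι c`,
`ι (R x c) = ι c * σ x`, `ι (ω x y) = σ x * σ y − σ (x y)` are `k`-linear
(resp. `k`-bilinear) and satisfy conditions (i)–(vii) of an associative
extension datum for `(a, b)`. -/
theorem extension_gives_assoc_extension_datum
    {k : Type*} [Field k] {A B E : Type*}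
    [NonUnitalRing A] [Module k A] [SMulCommClass k A A] [IsScalarTower k A A]
    [NonUnitalRing B] [Module k B] [SMulCommClass k B B] [IsScalarTower k B B]
    [NonUnitalRing E] [Module k E] [SMulCommClass k E E] [IsScalarTower k E E]
    (ι : A →ₙₐ[k] E) (π : E →ₙₐ[k] B)
    (hinj : Function.Injective ι) (hsurj : Function.Surjective π)
    (hker : ∀ z : E, π z = 0 ↔ z ∈ Set.range ι)
    (σ : B →ₗ[k] E) (hσ : ∀ x : B, π (σ x) = x) :
    (∀ (x : B) (c : A), σ x * ι c ∈ Set.range ι) ∧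
    (∀ (x : B) (c : A), ι c * σ x ∈ Set.range ι) ∧
    (∀ x y : B, σ x * σ y - σ (x * y) ∈ Set.range ι) ∧
    (∀ (L R : B → A → A) (ω : B → B → A),
      (∀ (x : B) (c : A), ι (L x c) = σ x * ι c) →
      (∀ (x : B) (c : A), ι (R x c) = ι c * σ x) →
      (∀ x y : B, ι (ω x y) = σ x * σ y - σ (x * y)) →
      ((∀ x : B, IsLinearMap k (L x)) ∧
       (∀ c : A, IsLinearMap k (fun x : B => L x c)) ∧
       (∀ x : B, IsLinearMap k (R x)) ∧
       (∀ c : A, IsLinearMap k (fun x : B => R x c)) ∧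
       (∀ x : B, IsLinearMap k (ω x)) ∧
       (∀ y : B, IsLinearMap k (fun x : B => ω x y)) ∧
       (∀ (x : B) (c c' : A), L x (c * c') = (L x c) * c') ∧
       (∀ (x : B) (c c' : A), R x (c * c') = c * (R x c')) ∧
       (∀ (x : B) (c c' : A), (R x c) * c' = c * (L x c')) ∧
       (∀ (x y : B) (c : A), L x (R y c) = R y (L x c)) ∧
       (∀ (x y : B) (c : A), L x (L y c) - L (x * y) c = (ω x y) * c) ∧
       (∀ (x y : B) (c : A), R y (R x c) - R (x * y) c = c * (ω x y)) ∧
       (∀ x y z : B,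
         ω (x * y) z + R z (ω x y) - ω x (y * z) - L x (ω y z) = 0))) := by
  refine ⟨fun x c => ?_, fun x c => ?_, fun x y => ?_, fun L R ω hL hR hω => ?_⟩
  · rw [← hker, map_mul, (hker (ι c)).2 ⟨c, rfl⟩, mul_zero]
  · rw [← hker, map_mul, (hker (ι c)).2 ⟨c, rfl⟩, zero_mul]
  · rw [← hker, map_sub, map_mul, hσ, hσ, hσ, sub_self]
  refine ⟨fun x => ⟨fun c c' => hinj ?_, fun t c => hinj ?_⟩,
    fun c => ⟨fun x y => hinj ?_, fun t x => hinj ?_⟩,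
    fun x => ⟨fun c c' => hinj ?_, fun t c => hinj ?_⟩,
    fun c => ⟨fun x y => hinj ?_, fun t x => hinj ?_⟩,
    fun x => ⟨fun y y' => hinj ?_, fun t y => hinj ?_⟩,
    fun y => ⟨fun x x' => hinj ?_, fun t x => hinj ?_⟩,
    fun x c c' => hinj ?_, fun x c c' => hinj ?_, fun x c c' => hinj ?_,
    fun x y c => hinj ?_, fun x y c => hinj ?_, fun x y c => hinj ?_,
    fun x y z => hinj ?_⟩ <;>
  simp only [hL, hR, hω, map_add, map_sub, map_mul, map_smul, map_zero, mul_add, add_mul,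
    mul_sub, sub_mul, mul_assoc, mul_smul_comm, smul_mul_assoc, smul_sub] <;>
  abel
end

section
/- Let (e,ι,π) be an extension of a by b, let σ : b → e be a k-linear map with π ∘ σ = id_b, and let (L,R,ω) be the associative extension datum determined by σ (ι(L x c) = σ(x) ι(c), ι(R x c) = ι(c) σ(x), ι(ω x y) = σ(x) σ(y) − σ(x y)). Then the k-linear map φ : E(L,R,ω) → e, (c,x) ↦ ι(c) + σ(x), is a k-algebra isomorphism; moreover φ(c,0) = ι(c) for all c ∈ a and π(φ(c,x)) = x for all (c,x), so φ is an equivalence of extensions. (Necessity part of Corollary 2.7, following Lemma 2.4.) -/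
/-- Necessity part of Corollary 2.7 (following Lemma 2.4): given an extension
`(e, ι, π)` of `a` by `b`, a `k`-linear section `σ` of `π`, and the associative
extension datum `(L, R, ω)` determined by `σ`, the `k`-linear map
`φ : E(L,R,ω) → e`, `(c,x) ↦ ι c + σ x`, is a `k`-algebra isomorphism, with
`φ (c,0) = ι c` and `π (φ (c,x)) = x`; so `φ` is an equivalence of
extensions. -/
theorem extension_isomorphic_to_E
    {k : Type*} [Field k] {A B E : Type*}
    [NonUnitalRing A] [Module k A] [SMulCommClass k A A] [IsScalarTower k A A]
    [NonUnitalRing B] [Module k B] [SMulCommClass k B B] [IsScalarTower k B B]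
    [NonUnitalRing E] [Module k E] [SMulCommClass k E E] [IsScalarTower k E E]
    (ι : A →ₙₐ[k] E) (π : E →ₙₐ[k] B)
    (hinj : Function.Injective ι) (hsurj : Function.Surjective π)
    (hker : ∀ z : E, π z = 0 ↔ z ∈ Set.range ι)
    (σ : B →ₗ[k] E) (hσ : ∀ x : B, π (σ x) = x)
    (L R : B →ₗ[k] Module.End k A) (ω : B →ₗ[k] B →ₗ[k] A)
    (hL : ∀ (x : B) (c : A), ι (L x c) = σ x * ι c)
    (hR : ∀ (x : B) (c : A), ι (R x c) = ι c * σ x)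
    (hω : ∀ x y : B, ι (ω x y) = σ x * σ y - σ (x * y))
    (m : A × B → A × B → A × B)
    (hm : ∀ p q : A × B,
      m p q = (p.1 * q.1 + L p.2 q.1 + R q.2 p.1 + ω p.2 q.2, p.2 * q.2))
    (φ : A × B → E) (hφ : ∀ p : A × B, φ p = ι p.1 + σ p.2) :
    Function.Bijective φ ∧
    (∀ u v : A × B, φ (u + v) = φ u + φ v) ∧
    (∀ (t : k) (u : A × B), φ (t • u) = t • φ u) ∧
    (∀ u v : A × B, φ (m u v) = φ u * φ v) ∧
    (∀ c : A, φ (c, 0) = ι c) ∧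
    (∀ p : A × B, π (φ p) = p.2) := by
  have hπι (c : A) : π (ι c) = 0 := (hker _).2 ⟨c, rfl⟩
  have hπφ (p : A × B) : π (φ p) = p.2 := by
    rw [hφ, map_add, hπι, hσ, zero_add]
  refine ⟨⟨fun p q h => ?_, fun z => ?_⟩, fun u v => ?_, fun t u => ?_, fun u v => ?_,
    fun c => by simp [hφ], hπφ⟩
  · have h₂ : p.2 = q.2 := by rw [← hπφ p, ← hπφ q, h]
    rw [hφ, hφ, h₂, add_left_inj] at h
    exact Prod.ext (hinj h) h₂
  · obtain ⟨c, hc⟩ := (hker (z - σ (π z))).1 (by rw [map_sub, hσ, sub_self])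
    exact ⟨(c, π z), by rw [hφ, hc, sub_add_cancel]⟩
  · simp only [hφ, Prod.fst_add, Prod.snd_add, map_add]
    abel
  · simp only [hφ, Prod.smul_fst, Prod.smul_snd, map_smul, smul_add]
  · simp only [hφ, hm, map_add, map_mul, hL, hR, hω, add_mul, mul_add]
    abel
end

section
/- Suppose c c' = 0 for all c,c' ∈ a (a is square-zero) and let (e,ι,π) be an extension of a by b. Then there exist a b-bimodule structure (L,R) on a and a Hochschild-type 2-cocycle ω : b × b → a for (L,R) such that the k-module a × b with multiplication (c,x)(c',x') = (L x c' + R x' c + ω x x', x x') is an associative k-algebra isomorphic to e via an isomorphism φ with φ(c,0) = ι(c) and π(φ(c,x)) = x for all c ∈ a, x ∈ b. (Necessity part of Corollary 2.9; equivalently MacLane's description of singular extensions of associative algebras.) -/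
/-- Necessity part of Corollary 2.9 (MacLane's description of singular
extensions): if `a` is square-zero and `(e, ι, π)` is an extension of `a` by
`b`, then there exist a `b`-bimodule structure `(L, R)` on `a` and a
Hochschild-type 2-cocycle `ω` for `(L, R)` such that `a × b` with
multiplication `(c,x)(c',x') = (L x c' + R x' c + ω x x', x x')` is an
associative `k`-algebra isomorphic to `e` via an isomorphism `φ` with
`φ (c,0) = ι c` and `π (φ (c,x)) = x`. -/
theorem square_zero_extension_is_cocycle_extension
    {k : Type*} [Field k] {A B E : Type*}
    [NonUnitalRing A] [Module k A] [SMulCommClass k A A] [IsScalarTower k A A]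
    [NonUnitalRing B] [Module k B] [SMulCommClass k B B] [IsScalarTower k B B]
    [NonUnitalRing E] [Module k E] [SMulCommClass k E E] [IsScalarTower k E E]
    (hsq : ∀ c c' : A, c * c' = 0)
    (ι : A →ₙₐ[k] E) (π : E →ₙₐ[k] B)
    (hinj : Function.Injective ι) (hsurj : Function.Surjective π)
    (hker : ∀ z : E, π z = 0 ↔ z ∈ Set.range ι) :
    ∃ (L R : B →ₗ[k] Module.End k A) (ω : B →ₗ[k] B →ₗ[k] A),
      (∀ (x y : B) (c : A), L (x * y) c = L x (L y c)) ∧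
      (∀ (x y : B) (c : A), R (x * y) c = R y (R x c)) ∧
      (∀ (x y : B) (c : A), L x (R y c) = R y (L x c)) ∧
      (∀ x y z : B,
        ω (x * y) z + R z (ω x y) - ω x (y * z) - L x (ω y z) = 0) ∧
      ∃ φ : A × B → E,
        (let m : A × B → A × B → A × B := fun p q =>
          (L p.2 q.1 + R q.2 p.1 + ω p.2 q.2, p.2 * q.2)
        (∀ u v w : A × B, m (m u v) w = m u (m v w)) ∧
        Function.Bijective φ ∧
        (∀ u v : A × B, φ (u + v) = φ u + φ v) ∧
        (∀ (t : k) (u : A × B), φ (t • u) = t • φ u) ∧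
        (∀ u v : A × B, φ (m u v) = φ u * φ v)) ∧
        (∀ c : A, φ (c, 0) = ι c) ∧
        (∀ p : A × B, π (φ p) = p.2) := by
  obtain ⟨s, hs⟩ := LinearMap.exists_rightInverse_of_surjective (π : E →ₗ[k] B)
    (LinearMap.range_eq_top.2 hsurj)
  obtain ⟨p, hp⟩ := LinearMap.exists_leftInverse_of_injective (ι : A →ₗ[k] E)
    (LinearMap.ker_eq_bot.2 hinj)
  have hπs : ∀ x, π (s x) = x := fun x => LinearMap.congr_fun hs x
  have hpι : ∀ c, p (ι c) = c := fun c => LinearMap.congr_fun hp c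
  have hπι : ∀ c, π (ι c) = 0 := fun c => (hker _).2 ⟨c, rfl⟩
  have hιp : ∀ z, π z = 0 → ι (p z) = z := by
    intro z hz
    obtain ⟨c, rfl⟩ := (hker z).1 hz
    rw [hpι]
  have hιι : ∀ c c', ι c * ι c' = 0 := fun c c' => by rw [← map_mul, hsq, map_zero]
  -- The kernel of `π` annihilates the image of `ι`.
  have hl : ∀ z w c, π z = π w → z * ι c = w * ι c := by
    intro z w c h
    obtain ⟨d, hd⟩ := (hker (z - w)).1 (by rw [map_sub, h, sub_self])
    rw [← sub_eq_zero, ← sub_mul, ← hd, hιι]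
  have hr : ∀ z w c, π z = π w → ι c * z = ι c * w := by
    intro z w c h
    obtain ⟨d, hd⟩ := (hker (z - w)).1 (by rw [map_sub, h, sub_self])
    rw [← sub_eq_zero, ← mul_sub, ← hd, hιι]
  let L : B →ₗ[k] Module.End k A := LinearMap.mk₂ k (fun x c => p (s x * ι c))
    (by intros; simp [add_mul]) (by intros; simp [smul_mul_assoc])
    (by intros; simp [mul_add]) (by intros; simp [mul_smul_comm])
  let R : B →ₗ[k] Module.End k A := LinearMap.mk₂ k (fun x c => p (ι c * s x))
    (by intros; simp [mul_add]) (by intros; simp [mul_smul_comm])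
    (by intros; simp [add_mul]) (by intros; simp [smul_mul_assoc])
  let ω : B →ₗ[k] B →ₗ[k] A := LinearMap.mk₂ k (fun x y => p (s x * s y - s (x * y)))
    (by intros; simp only [add_mul, map_add, map_sub]; abel)
    (by intros; simp only [smul_mul_assoc, map_smul, map_sub, smul_sub])
    (by intros; simp only [mul_add, map_add, map_sub]; abel)
    (by intros; simp only [mul_smul_comm, map_smul, map_sub, smul_sub])
  have hL : ∀ x c, ι (L x c) = s x * ι c := fun x c => hιp _ (by simp [hπι])
  have hR : ∀ x c, ι (R x c) = ι c * s x := fun x c => hιp _ (by simp [hπι])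
  have hω : ∀ x y, ι (ω x y) = s x * s y - s (x * y) := fun x y => hιp _ (by simp [hπs])
  let φ : A × B → E := fun u => ι u.1 + s u.2
  have hφinj : Function.Injective φ := by
    rintro ⟨c, x⟩ ⟨d, y⟩ h
    have h' : ι c + s x = ι d + s y := h
    have hxy : x = y := by simpa [hπι, hπs] using congrArg π h'
    subst hxy
    rw [hinj (add_right_cancel h')]
  let m : A × B → A × B → A × B := fun u v =>
    (L u.2 v.1 + R v.2 u.1 + ω u.2 v.2, u.2 * v.2)
  have hφmul : ∀ u v, φ (m u v) = φ u * φ v := by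
    intro u v
    simp only [φ, m, map_add, hL, hR, hω, add_mul, mul_add, hιι]
    abel
  refine ⟨L, R, ω, ?_, ?_, ?_, ?_, φ, ⟨?_, ⟨hφinj, ?_⟩, ?_, ?_, hφmul⟩, ?_, ?_⟩
  · intro x y c
    apply hinj
    rw [hL, hL, hL, ← mul_assoc]
    exact hl _ _ _ (by simp [hπs])
  · intro x y c
    apply hinj
    rw [hR, hR, hR, mul_assoc]
    exact hr _ _ _ (by simp [hπs])
  · intro x y c
    apply hinj
    rw [hL, hR, hR, hL, mul_assoc]
  · intro x y z
    apply hinj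
    simp only [map_sub, map_add, map_zero, hL, hR, hω, sub_mul, mul_sub, mul_assoc]
    abel
  · intro u v w
    change m (m u v) w = m u (m v w)
    apply hφinj
    simp only [hφmul, mul_assoc]
  · intro z
    refine ⟨(p (z - s (π z)), π z), ?_⟩
    simp only [φ]
    rw [hιp _ (by simp [hπs]), sub_add_cancel]
  · intro u v
    simp only [φ, Prod.fst_add, Prod.snd_add, map_add]
    abel
  · intro t u
    simp only [φ, Prod.smul_fst, Prod.smul_snd, map_smul, smul_add]
  · intro c
    simp [φ]
  · intro u
    simp [φ, hπι, hπs]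
end

section
/- Let (L,R,ω) and (L',R',ω') be associative extension data for (a,b), and equip E(L,R,ω) and E(L',R',ω') with their canonical extension structures (inclusion c ↦ (c,0), projection (c,x) ↦ x). Then these two extensions of a by b are equivalent if and only if there exists a k-linear map η : b → a such that for all x,y ∈ b and c ∈ a: L' x c − L x c = (η x) c, R' x c − R x c = c (η x), and ω' x y = ω x y − η(x y) + L' x (η y) + R' y (η x) − (η x)(η y). (Theorem 2.5(II), specialized to the case where b is given by its multiplication table, with the normal-form reduction computed explicitly; the equivalence is realized by φ(c,x) = (c − η x, x).) -/
/-- Theorem 2.5(II), specialized: two extensions `E(L,R,ω)` and `E(L',R',ω')`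
of `a` by `b` (with canonical inclusion `c ↦ (c,0)` and projection
`(c,x) ↦ x`) are equivalent if and only if there is a `k`-linear map
`η : b → a` such that `L' x c − L x c = (η x) c`, `R' x c − R x c = c (η x)`
and `ω' x y = ω x y − η (x y) + L' x (η y) + R' y (η x) − (η x)(η y)`;
the equivalence is realized by `φ (c,x) = (c − η x, x)`. -/
theorem assoc_extensions_equivalent_iff
    {k : Type*} [Field k] {A B : Type*}
    [NonUnitalRing A] [Module k A] [SMulCommClass k A A] [IsScalarTower k A A]
    [NonUnitalRing B] [Module k B] [SMulCommClass k B B] [IsScalarTower k B B]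
    (L R : B →ₗ[k] Module.End k A) (ω : B →ₗ[k] B →ₗ[k] A)
    (h1 : ∀ (x : B) (c c' : A), L x (c * c') = (L x c) * c')
    (h2 : ∀ (x : B) (c c' : A), R x (c * c') = c * (R x c'))
    (h3 : ∀ (x : B) (c c' : A), (R x c) * c' = c * (L x c'))
    (h4 : ∀ (x y : B) (c : A), L x (R y c) = R y (L x c))
    (h5 : ∀ (x y : B) (c : A), L x (L y c) - L (x * y) c = (ω x y) * c)
    (h6 : ∀ (x y : B) (c : A), R y (R x c) - R (x * y) c = c * (ω x y))
    (h7 : ∀ x y z : B, ω (x * y) z + R z (ω x y) - ω x (y * z) - L x (ω y z) = 0)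
    (L' R' : B →ₗ[k] Module.End k A) (ω' : B →ₗ[k] B →ₗ[k] A)
    (h1' : ∀ (x : B) (c c' : A), L' x (c * c') = (L' x c) * c')
    (h2' : ∀ (x : B) (c c' : A), R' x (c * c') = c * (R' x c'))
    (h3' : ∀ (x : B) (c c' : A), (R' x c) * c' = c * (L' x c'))
    (h4' : ∀ (x y : B) (c : A), L' x (R' y c) = R' y (L' x c))
    (h5' : ∀ (x y : B) (c : A), L' x (L' y c) - L' (x * y) c = (ω' x y) * c)
    (h6' : ∀ (x y : B) (c : A), R' y (R' x c) - R' (x * y) c = c * (ω' x y))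
    (h7' : ∀ x y z : B,
      ω' (x * y) z + R' z (ω' x y) - ω' x (y * z) - L' x (ω' y z) = 0)
    (m m' : A × B → A × B → A × B)
    (hm : ∀ p q : A × B,
      m p q = (p.1 * q.1 + L p.2 q.1 + R q.2 p.1 + ω p.2 q.2, p.2 * q.2))
    (hm' : ∀ p q : A × B,
      m' p q = (p.1 * q.1 + L' p.2 q.1 + R' q.2 p.1 + ω' p.2 q.2, p.2 * q.2)) :
    (∃ φ : A × B → A × B,
      (∀ u v : A × B, φ (u + v) = φ u + φ v) ∧
      (∀ (t : k) (u : A × B), φ (t • u) = t • φ u) ∧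
      (∀ u v : A × B, φ (m u v) = m' (φ u) (φ v)) ∧
      (∀ c : A, φ (c, 0) = (c, 0)) ∧
      (∀ p : A × B, (φ p).2 = p.2)) ↔
    (∃ η : B →ₗ[k] A,
      (∀ (x : B) (c : A), L' x c - L x c = (η x) * c) ∧
      (∀ (x : B) (c : A), R' x c - R x c = c * (η x)) ∧
      (∀ x y : B, ω' x y =
        ω x y - η (x * y) + L' x (η y) + R' y (η x) - (η x) * (η y))) := by
  constructor
  · rintro ⟨φ, hadd, hsmul, hmul, hι, hπ⟩
    have hφ : ∀ x : B, φ (0, x) = ((φ (0, x)).1, x) := fun x => Prod.ext rfl (hπ (0, x))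
    refine ⟨
      { toFun := fun x => -(φ (0, x)).1
        map_add' := fun x y => ?_
        map_smul' := fun t x => ?_ }, fun x c => ?_, fun x c => ?_, fun x y => ?_⟩
    · have h := congrArg Prod.fst (hadd (0, x) (0, y))
      simp only [Prod.mk_add_mk, add_zero, Prod.fst_add] at h
      rw [h, neg_add]
    · have h := congrArg Prod.fst (hsmul t (0, x))
      simp only [Prod.smul_mk, smul_zero, Prod.smul_fst] at h
      rw [h, RingHom.id_apply, smul_neg]
    · have h := congrArg Prod.fst (hmul (0, x) (c, 0))
      rw [hφ x, hι, hm, hm'] at h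
      simp [hι] at h
      simp [h]
    · have h := congrArg Prod.fst (hmul (c, 0) (0, x))
      rw [hφ x, hι, hm, hm'] at h
      simp [hι] at h
      simp [h]
    · have hsplit : φ (ω x y, x * y) = (ω x y, 0) + φ (0, x * y) := by
        rw [← hι, ← hadd]
        simp
      have h := congrArg Prod.fst (hmul (0, x) (0, y))
      rw [hφ x, hφ y, hm, hm'] at h
      simp [hsplit] at h
      simp only [LinearMap.coe_mk, AddHom.coe_mk, map_neg, neg_mul_neg, sub_neg_eq_add]
      rw [h]
      abel
  · rintro ⟨η, hL, hR, hω⟩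
    refine ⟨fun p => (p.1 - η p.2, p.2), fun u v => ?_, fun t u => ?_, fun u v => ?_,
      fun c => ?_, fun p => rfl⟩
    · ext <;> simp
      abel
    · ext <;> simp [smul_sub]
    · rw [hm, hm']
      ext
      · have e1 := eq_add_of_sub_eq (hL u.2 v.1)
        have e2 := eq_add_of_sub_eq (hR v.2 u.1)
        simp only [map_sub, hω, e1, e2, sub_mul, mul_sub]
        abel
      · rfl
    · simp
end

section
/- Let (e,ι,π) be an extension of the Lie algebra a by the Lie algebra b and let σ : b → e be a k-linear map with π ∘ σ = id_b. Then for all x,y ∈ b and c ∈ a the elements ⁅σ(x), ι(c)⁆ and ⁅σ(x), σ(y)⁆ − σ(⁅x,y⁆) of e lie in the range of ι, and the uniquely determined maps ρ : b → End_k(a) and ω : b × b → a satisfying ι(ρ x c) = ⁅σ(x), ι(c)⁆ and ι(ω x y) = ⁅σ(x), σ(y)⁆ − σ(⁅x,y⁆) are k-linear (respectively alternating k-bilinear) and form a Lie extension datum for (a,b): each ρ x is a derivation of a, and conditions (A) and (B) hold. (Necessity part of Corollary 3.9, following Lemma 3.6.) -/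
/-- Necessity part of Corollary 3.9 (following Lemma 3.6): given an extension
`(e, ι, π)` of the Lie algebra `a` by the Lie algebra `b` and a `k`-linear
section `σ` of `π`, the elements `⁅σ x, ι c⁆` and `⁅σ x, σ y⁆ − σ ⁅x,y⁆` lie
in the range of `ι`, and the maps `ρ`, `ω` determined by
`ι (ρ x c) = ⁅σ x, ι c⁆` and `ι (ω x y) = ⁅σ x, σ y⁆ − σ ⁅x,y⁆` are
`k`-linear (resp. alternating `k`-bilinear) and form a Lie extension datum
for `(a, b)`: each `ρ x` is a derivation, and conditions (A) and (B) hold. -/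
theorem lie_extension_gives_lie_extension_datum
    {k : Type*} [Field k] {A B E : Type*}
    [LieRing A] [LieAlgebra k A] [LieRing B] [LieAlgebra k B]
    [LieRing E] [LieAlgebra k E]
    (ι : A →ₗ⁅k⁆ E) (π : E →ₗ⁅k⁆ B)
    (hinj : Function.Injective ι) (hsurj : Function.Surjective π)
    (hker : ∀ z : E, π z = 0 ↔ z ∈ Set.range ι)
    (σ : B →ₗ[k] E) (hσ : ∀ x : B, π (σ x) = x) :
    (∀ (x : B) (c : A), ⁅σ x, ι c⁆ ∈ Set.range ι) ∧
    (∀ x y : B, ⁅σ x, σ y⁆ - σ ⁅x, y⁆ ∈ Set.range ι) ∧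
    (∀ (ρ : B → A → A) (ω : B → B → A),
      (∀ (x : B) (c : A), ι (ρ x c) = ⁅σ x, ι c⁆) →
      (∀ x y : B, ι (ω x y) = ⁅σ x, σ y⁆ - σ ⁅x, y⁆) →
      ((∀ x : B, IsLinearMap k (ρ x)) ∧
       (∀ c : A, IsLinearMap k (fun x : B => ρ x c)) ∧
       (∀ x : B, IsLinearMap k (ω x)) ∧
       (∀ y : B, IsLinearMap k (fun x : B => ω x y)) ∧
       (∀ x : B, ω x x = 0) ∧
       (∀ (x : B) (c c' : A), ρ x ⁅c, c'⁆ = ⁅ρ x c, c'⁆ + ⁅c, ρ x c'⁆) ∧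
       (∀ (x y : B) (c : A),
         ρ x (ρ y c) - ρ y (ρ x c) - ρ ⁅x, y⁆ c = ⁅ω x y, c⁆) ∧
       (∀ x y z : B,
         ρ x (ω y z) - ω ⁅x, y⁆ z + ρ y (ω z x) - ω ⁅y, z⁆ x
           + ρ z (ω x y) - ω ⁅z, x⁆ y = 0))) := by
  refine ⟨fun x c => ?_, fun x y => ?_, fun ρ ω hρ hω =>
    ⟨fun x => ⟨fun c d => hinj ?_, fun t c => hinj ?_⟩,
    fun c => ⟨fun x y => hinj ?_, fun t x => hinj ?_⟩,
    fun x => ⟨fun y z => hinj ?_, fun t y => hinj ?_⟩,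
    fun y => ⟨fun x z => hinj ?_, fun t x => hinj ?_⟩,
    fun x => hinj ?_, fun x c c' => hinj ?_, fun x y c => hinj ?_, fun x y z => hinj ?_⟩⟩
  · rw [← hker, LieHom.map_lie, (hker (ι c)).2 ⟨c, rfl⟩, lie_zero]
  · rw [← hker, map_sub, LieHom.map_lie, hσ, hσ, hσ, sub_self]
  · simp only [map_add, hρ, lie_add]
  · simp only [map_smul, hρ, lie_smul]
  · simp only [map_add, hρ, add_lie]
  · simp only [map_smul, hρ, smul_lie]
  · simp only [map_add, hω, lie_add]
    abel
  · simp only [map_smul, hω, lie_smul, smul_sub]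
  · simp only [map_add, hω, add_lie]
    abel
  · simp only [map_smul, hω, smul_lie, smul_sub]
  · simp only [hω, lie_self, map_zero, sub_self]
  · simp only [map_add, LieHom.map_lie, hρ, leibniz_lie (σ x) (ι c) (ι c')]
  · simp only [map_sub, LieHom.map_lie, hρ, hω, sub_lie, lie_lie]
  · have hE := lie_jacobi (σ x) (σ y) (σ z)
    have hB : σ ⁅⁅x, y⁆, z⁆ + σ ⁅⁅y, z⁆, x⁆ + σ ⁅⁅z, x⁆, y⁆ = 0 := by
      rw [← map_add, ← map_add, ← lie_skew ⁅x, y⁆ z, ← lie_skew ⁅y, z⁆ x, ← lie_skew ⁅z, x⁆ y,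
        ← neg_add, ← neg_add, add_assoc, add_comm, lie_jacobi, neg_zero, map_zero]
    simp only [map_sub, map_add, hρ, hω, lie_sub, map_zero]
    rw [← lie_skew (σ z) (σ ⁅x, y⁆), ← lie_skew (σ x) (σ ⁅y, z⁆), ← lie_skew (σ y) (σ ⁅z, x⁆)]
    linear_combination (norm := abel) hE + hB
end

section
/- Let (e,ι,π) be an extension of the Lie algebra a by the Lie algebra b, let σ : b → e be a k-linear map with π ∘ σ = id_b, and let (ρ,ω) be the Lie extension datum determined by σ (ι(ρ x c) = ⁅σ(x), ι(c)⁆, ι(ω x y) = ⁅σ(x), σ(y)⁆ − σ(⁅x,y⁆)). Then the k-linear map φ : LieE(ρ,ω) → e, (c,x) ↦ ι(c) + σ(x), is an isomorphism of Lie algebras; moreover φ(c,0) = ι(c) for all c ∈ a and π(φ(c,x)) = x for all (c,x), so φ is an equivalence of extensions. (Necessity part of Corollary 3.9, following Lemma 3.6.) -/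
/-- Necessity part of Corollary 3.9 (following Lemma 3.6): given an extension
`(e, ι, π)` of the Lie algebra `a` by the Lie algebra `b`, a `k`-linear
section `σ` of `π`, and the Lie extension datum `(ρ, ω)` determined by `σ`,
the `k`-linear map `φ : LieE(ρ,ω) → e`, `(c,x) ↦ ι c + σ x`, is an
isomorphism of Lie algebras, with `φ (c,0) = ι c` and `π (φ (c,x)) = x`; so
`φ` is an equivalence of extensions. -/
theorem lie_extension_isomorphic_to_LieE
    {k : Type*} [Field k] {A B E : Type*}
    [LieRing A] [LieAlgebra k A] [LieRing B] [LieAlgebra k B]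
    [LieRing E] [LieAlgebra k E]
    (ι : A →ₗ⁅k⁆ E) (π : E →ₗ⁅k⁆ B)
    (hinj : Function.Injective ι) (hsurj : Function.Surjective π)
    (hker : ∀ z : E, π z = 0 ↔ z ∈ Set.range ι)
    (σ : B →ₗ[k] E) (hσ : ∀ x : B, π (σ x) = x)
    (ρ : B →ₗ[k] Module.End k A) (ω : B →ₗ[k] B →ₗ[k] A)
    (hρ : ∀ (x : B) (c : A), ι (ρ x c) = ⁅σ x, ι c⁆)
    (hω : ∀ x y : B, ι (ω x y) = ⁅σ x, σ y⁆ - σ ⁅x, y⁆)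
    (br : A × B → A × B → A × B)
    (hbr : ∀ p q : A × B,
      br p q = (⁅p.1, q.1⁆ + ρ p.2 q.1 - ρ q.2 p.1 + ω p.2 q.2, ⁅p.2, q.2⁆))
    (φ : A × B → E) (hφ : ∀ p : A × B, φ p = ι p.1 + σ p.2) :
    Function.Bijective φ ∧
    (∀ u v : A × B, φ (u + v) = φ u + φ v) ∧
    (∀ (t : k) (u : A × B), φ (t • u) = t • φ u) ∧
    (∀ u v : A × B, φ (br u v) = ⁅φ u, φ v⁆) ∧
    (∀ c : A, φ (c, 0) = ι c) ∧
    (∀ p : A × B, π (φ p) = p.2) := by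
  have hπι : ∀ c : A, π (ι c) = 0 := fun c => (hker _).2 ⟨c, rfl⟩
  have hπφ : ∀ p : A × B, π (φ p) = p.2 := fun p => by
    rw [hφ, map_add, hπι, hσ, zero_add]
  refine ⟨⟨fun p q h => ?_, fun z => ?_⟩, fun u v => ?_, fun t u => ?_, fun u v => ?_,
    fun c => ?_, hπφ⟩
  · have h2 : p.2 = q.2 := by rw [← hπφ p, h, hπφ q]
    rw [hφ, hφ, h2] at h
    exact Prod.ext (hinj (add_right_cancel h)) h2
  · obtain ⟨c, hc⟩ := (hker (z - σ (π z))).1 (by rw [map_sub, hσ, sub_self])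
    exact ⟨(c, π z), by rw [hφ, hc, sub_add_cancel]⟩
  · simp only [hφ, Prod.fst_add, Prod.snd_add, map_add]
    abel
  · simp only [hφ, Prod.smul_fst, Prod.smul_snd, map_smul, smul_add]
  · simp only [hφ, hbr, map_add, map_sub, LieHom.map_lie, hρ, hω, lie_add, add_lie]
    rw [← lie_skew (ι u.1) (σ v.2)]
    abel
  · simp [hφ]
end

section
/- Let (ρ,ω) and (ρ',ω') be Lie extension data for (a,b), and equip LieE(ρ,ω) and LieE(ρ',ω') with their canonical extension structures (inclusion c ↦ (c,0), projection (c,x) ↦ x). Then these two extensions of a by b are equivalent if and only if there exists a k-linear map η : b → a such that for all x,y ∈ b and c ∈ a: ρ' x c − ρ x c = ⁅η x, c⁆ and ω' x y = ω x y − η(⁅x,y⁆) + ρ' x (η y) − ρ' y (η x) − ⁅η x, η y⁆. (Theorem 3.7(II), specialized to the case where b is given by its multiplication table, with the normal-form reduction computed explicitly; the equivalence is realized by φ(c,x) = (c − η x, x).) -/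
/-- Theorem 3.7(II), specialized: two extensions `LieE(ρ,ω)` and `LieE(ρ',ω')`
of `a` by `b` (with canonical inclusion `c ↦ (c,0)` and projection
`(c,x) ↦ x`) are equivalent if and only if there is a `k`-linear map
`η : b → a` such that `ρ' x c − ρ x c = ⁅η x, c⁆` and
`ω' x y = ω x y − η ⁅x,y⁆ + ρ' x (η y) − ρ' y (η x) − ⁅η x, η y⁆`;
the equivalence is realized by `φ (c,x) = (c − η x, x)`. -/
theorem lie_extensions_equivalent_iff
    {k : Type*} [Field k] {A B : Type*}
    [LieRing A] [LieAlgebra k A] [LieRing B] [LieAlgebra k B]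
    (ρ : B →ₗ[k] Module.End k A)
    (hder : ∀ (x : B) (c c' : A), ρ x ⁅c, c'⁆ = ⁅ρ x c, c'⁆ + ⁅c, ρ x c'⁆)
    (ω : B →ₗ[k] B →ₗ[k] A) (halt : ∀ x : B, ω x x = 0)
    (hA : ∀ (x y : B) (c : A),
      ρ x (ρ y c) - ρ y (ρ x c) - ρ ⁅x, y⁆ c = ⁅ω x y, c⁆)
    (hB : ∀ x y z : B,
      ρ x (ω y z) - ω ⁅x, y⁆ z + ρ y (ω z x) - ω ⁅y, z⁆ x
        + ρ z (ω x y) - ω ⁅z, x⁆ y = 0)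
    (ρ' : B →ₗ[k] Module.End k A)
    (hder' : ∀ (x : B) (c c' : A), ρ' x ⁅c, c'⁆ = ⁅ρ' x c, c'⁆ + ⁅c, ρ' x c'⁆)
    (ω' : B →ₗ[k] B →ₗ[k] A) (halt' : ∀ x : B, ω' x x = 0)
    (hA' : ∀ (x y : B) (c : A),
      ρ' x (ρ' y c) - ρ' y (ρ' x c) - ρ' ⁅x, y⁆ c = ⁅ω' x y, c⁆)
    (hB' : ∀ x y z : B,
      ρ' x (ω' y z) - ω' ⁅x, y⁆ z + ρ' y (ω' z x) - ω' ⁅y, z⁆ x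
        + ρ' z (ω' x y) - ω' ⁅z, x⁆ y = 0)
    (br br' : A × B → A × B → A × B)
    (hbr : ∀ p q : A × B,
      br p q = (⁅p.1, q.1⁆ + ρ p.2 q.1 - ρ q.2 p.1 + ω p.2 q.2, ⁅p.2, q.2⁆))
    (hbr' : ∀ p q : A × B,
      br' p q = (⁅p.1, q.1⁆ + ρ' p.2 q.1 - ρ' q.2 p.1 + ω' p.2 q.2, ⁅p.2, q.2⁆)) :
    (∃ φ : A × B → A × B,
      (∀ u v : A × B, φ (u + v) = φ u + φ v) ∧
      (∀ (t : k) (u : A × B), φ (t • u) = t • φ u) ∧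
      (∀ u v : A × B, φ (br u v) = br' (φ u) (φ v)) ∧
      (∀ c : A, φ (c, 0) = (c, 0)) ∧
      (∀ p : A × B, (φ p).2 = p.2)) ↔
    (∃ η : B →ₗ[k] A,
      (∀ (x : B) (c : A), ρ' x c - ρ x c = ⁅η x, c⁆) ∧
      (∀ x y : B, ω' x y =
        ω x y - η ⁅x, y⁆ + ρ' x (η y) - ρ' y (η x) - ⁅η x, η y⁆)) := by
  constructor
  · rintro ⟨φ, hadd, hsmul, hφ, hincl, hproj⟩
    let η : B →ₗ[k] A :=
      { toFun := fun x => -(φ (0, x)).1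
        map_add' := fun x y => by
          have h := hadd (0, x) (0, y)
          rw [Prod.mk_add_mk, add_zero] at h
          rw [h, Prod.fst_add, neg_add]
        map_smul' := fun t x => by
          have h := hsmul t (0, x)
          rw [Prod.smul_mk, smul_zero] at h
          rw [h, Prod.smul_fst, smul_neg, RingHom.id_apply] }
    have hφη (c : A) (x : B) : φ (c, x) = (c - η x, x) := by
      have h := hadd (c, 0) (0, x)
      rw [Prod.mk_add_mk, add_zero, zero_add, hincl] at h
      refine Prod.ext ?_ (hproj _)
      simp [h, η]
    refine ⟨η, fun x c => ?_, fun x y => ?_⟩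
    · have h := congrArg Prod.fst (hφ (0, x) (c, 0))
      simp only [hbr, hbr', hφη, zero_lie, lie_zero, map_zero, LinearMap.zero_apply, zero_sub,
        sub_zero, zero_add, add_zero, neg_lie] at h
      rw [h]
      abel
    · have h := congrArg Prod.fst (hφ (0, x) (0, y))
      simp only [hbr, hbr', hφη, zero_lie, map_zero, zero_sub, sub_zero, zero_add,
        neg_lie, lie_neg, neg_neg, map_neg] at h
      rw [h]
      abel
  · rintro ⟨η, hρ, hω⟩
    refine ⟨fun p => (p.1 - η p.2, p.2), fun u v => ?_, fun t u => ?_, fun u v => ?_,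
      fun c => ?_, fun _ => rfl⟩
    · ext
      · simp only [Prod.fst_add, Prod.snd_add, map_add]
        abel
      · rfl
    · ext
      · simp only [Prod.smul_fst, Prod.smul_snd, map_smul, smul_sub]
      · rfl
    · obtain ⟨c, x⟩ := u
      obtain ⟨d, y⟩ := v
      simp only [hbr, hbr', hω, map_sub, sub_lie, lie_sub]
      rw [← lie_skew c (η y), ← hρ x d, ← hρ y c]
      ext
      · dsimp only
        abel
      · rfl
    · simp
end
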